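/- arXiv:math/0703644 — 2 statements merged into one kernel-verified Lean document; each statement's English description precedes it below -/
import Mathlib

section
/- Assume W ⊥ W. (a) If W is closed under kernels of epimorphisms, then so is G(W): for every exact sequence 0 → N' → N → N'' → 0 in A with N and N'' in G(W), the object N' lies in G(W). (b) If W is closed under cokernels of monomorphisms, then so is G(W): for every exact sequence 0 → N' → N → N'' → 0 with N' and N in G(W), the object N'' lies in G(W). -/
open CategoryTheory CategoryTheory.Limits CategoryTheory.Abelian

universe w v u

variable {C : Type u} [Category.{v} C] [Abelian C]

/-- A class of objects is closed under isomorphisms. -/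
def IsoClosed (𝒲 : Set C) : Prop :=
  ∀ ⦃A B : C⦄, (A ≅ B) → A ∈ 𝒲 → B ∈ 𝒲

/-- A class of objects is closed under finite direct sums (part of being an
additive subcategory). -/
def SumClosed (𝒲 : Set C) : Prop :=
  ∀ ⦃A B : C⦄, A ∈ 𝒲 → B ∈ 𝒲 → (A ⊞ B) ∈ 𝒲

/-- A class of objects is closed under extensions. -/
def ExtensionClosed (𝒲 : Set C) : Prop :=
  ∀ ⦃A₁ A₂ A₃ : C⦄ (f : A₁ ⟶ A₂) (g : A₂ ⟶ A₃) (w : f ≫ g = 0),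
    (ShortComplex.mk f g w).ShortExact → A₁ ∈ 𝒲 → A₃ ∈ 𝒲 → A₂ ∈ 𝒲

/-- A class of objects is closed under kernels of epimorphisms. -/
def KerEpiClosed (𝒲 : Set C) : Prop :=
  ∀ ⦃A₁ A₂ A₃ : C⦄ (f : A₁ ⟶ A₂) (g : A₂ ⟶ A₃) (w : f ≫ g = 0),
    (ShortComplex.mk f g w).ShortExact → A₂ ∈ 𝒲 → A₃ ∈ 𝒲 → A₁ ∈ 𝒲

/-- A class of objects is closed under cokernels of monomorphisms. -/
def CokerMonoClosed (𝒲 : Set C) : Prop :=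
  ∀ ⦃A₁ A₂ A₃ : C⦄ (f : A₁ ⟶ A₂) (g : A₂ ⟶ A₃) (w : f ≫ g = 0),
    (ShortComplex.mk f g w).ShortExact → A₁ ∈ 𝒲 → A₂ ∈ 𝒲 → A₃ ∈ 𝒲

section ExtDefs

variable [HasExt.{w} C]

/-- `X ⊥ Y`, i.e. `Ext^i(X, Y) = 0` for all `i ≥ 1`. -/
def extPerp (X Y : C) : Prop :=
  ∀ i : ℕ, 1 ≤ i → Subsingleton (Abelian.Ext X Y i)

end ExtDefs

/-- `𝒲` is a cogenerator for `𝒳`: `𝒲 ⊆ 𝒳` and every object of `𝒳` embeds in an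
object of `𝒲` with cokernel in `𝒳`. -/
def IsCogen (𝒲 𝒳 : Set C) : Prop :=
  𝒲 ⊆ 𝒳 ∧ ∀ X ∈ 𝒳, ∃ (W X' : C) (i : X ⟶ W) (p : W ⟶ X') (w : i ≫ p = 0),
    W ∈ 𝒲 ∧ X' ∈ 𝒳 ∧ (ShortComplex.mk i p w).ShortExact

/-- `𝒱` is a generator for `𝒴`: `𝒱 ⊆ 𝒴` and every object of `𝒴` is a quotient of an
object of `𝒱` with kernel in `𝒴`. -/
def IsGen (𝒱 𝒴 : Set C) : Prop :=
  𝒱 ⊆ 𝒴 ∧ ∀ Y ∈ 𝒴, ∃ (Y' V : C) (i : Y' ⟶ V) (p : V ⟶ Y) (w : i ≫ p = 0),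
    V ∈ 𝒱 ∧ Y' ∈ 𝒴 ∧ (ShortComplex.mk i p w).ShortExact

section ExtDefs2

variable [HasExt.{w} C]

/-- `𝒲` is an injective cogenerator for `𝒳`. -/
def IsInjCogen (𝒲 𝒳 : Set C) : Prop :=
  IsCogen 𝒲 𝒳 ∧ ∀ X ∈ 𝒳, ∀ W ∈ 𝒲, extPerp X W

/-- `𝒱` is a projective generator for `𝒴`. -/
def IsProjGen (𝒱 𝒴 : Set C) : Prop :=
  IsGen 𝒱 𝒴 ∧ ∀ V ∈ 𝒱, ∀ Y ∈ 𝒴, extPerp V Y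

end ExtDefs2

/-- The data `(P, d, ε)` is a resolution of `M`: the augmented complex
`⋯ → P₁ → P₀ → M → 0` is exact. -/
structure IsResolution (P : ℕ → C) (d : ∀ n, P (n + 1) ⟶ P n) (M : C) (ε : P 0 ⟶ M) :
    Prop where
  w0 : d 0 ≫ ε = 0
  w : ∀ n, d (n + 1) ≫ d n = 0
  epi : Epi ε
  exact0 : (ShortComplex.mk (d 0) ε w0).Exact
  exact : ∀ n, (ShortComplex.mk (d (n + 1)) (d n) (w n)).Exact

/-- The data `(Q, δ, η)` is a coresolution of `M`: the augmented complex
`0 → M → Q⁰ → Q¹ → ⋯` is exact. -/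
structure IsCoresolution (Q : ℕ → C) (δ : ∀ n, Q n ⟶ Q (n + 1)) (M : C) (η : M ⟶ Q 0) :
    Prop where
  w0 : η ≫ δ 0 = 0
  w : ∀ n, δ n ≫ δ (n + 1) = 0
  mono : Mono η
  exact0 : (ShortComplex.mk η (δ 0) w0).Exact
  exact : ∀ n, (ShortComplex.mk (δ n) (δ (n + 1)) (w n)).Exact

/-- `Hom(W', -)` applied to the augmented complex `⋯ → P₁ → P₀ → M → 0` is exact for
every `W'` in `𝒳` (properness of the resolution). -/
def ResHomExact (𝒳 : Set C) (P : ℕ → C) (d : ∀ n, P (n + 1) ⟶ P n) {M : C}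
    (ε : P 0 ⟶ M) : Prop :=
  ∀ W ∈ 𝒳,
    (∀ φ : W ⟶ M, ∃ ψ : W ⟶ P 0, ψ ≫ ε = φ) ∧
    (∀ φ : W ⟶ P 0, φ ≫ ε = 0 → ∃ ψ : W ⟶ P 1, ψ ≫ d 0 = φ) ∧
    (∀ (n : ℕ) (φ : W ⟶ P (n + 1)), φ ≫ d n = 0 → ∃ ψ : W ⟶ P (n + 2), ψ ≫ d (n + 1) = φ)

/-- `Hom(-, W')` applied to the augmented complex `0 → M → Q⁰ → Q¹ → ⋯` is exact for
every `W'` in `𝒲` (properness of the coresolution). -/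
def CoresHomExact (𝒲 : Set C) (Q : ℕ → C) (δ : ∀ n, Q n ⟶ Q (n + 1)) {M : C}
    (η : M ⟶ Q 0) : Prop :=
  ∀ W ∈ 𝒲,
    (∀ φ : M ⟶ W, ∃ ψ : Q 0 ⟶ W, η ≫ ψ = φ) ∧
    (∀ φ : Q 0 ⟶ W, η ≫ φ = 0 → ∃ ψ : Q 1 ⟶ W, δ 0 ≫ ψ = φ) ∧
    (∀ (n : ℕ) (φ : Q (n + 1) ⟶ W), δ n ≫ φ = 0 → ∃ ψ : Q (n + 2) ⟶ W, δ (n + 1) ≫ ψ = φ)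

/-- `M` admits a proper `𝒳`-resolution, i.e. `M ∈ res~(𝒳)`. -/
def MemProperRes (𝒳 : Set C) (M : C) : Prop :=
  ∃ (P : ℕ → C) (d : ∀ n, P (n + 1) ⟶ P n) (ε : P 0 ⟶ M),
    (∀ n, P n ∈ 𝒳) ∧ IsResolution P d M ε ∧ ResHomExact 𝒳 P d ε

/-- `M` admits a proper `𝒲`-coresolution, i.e. `M ∈ cores~(𝒲)`. -/
def MemProperCores (𝒲 : Set C) (M : C) : Prop :=
  ∃ (Q : ℕ → C) (δ : ∀ n, Q n ⟶ Q (n + 1)) (η : M ⟶ Q 0),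
    (∀ n, Q n ∈ 𝒲) ∧ IsCoresolution Q δ M η ∧ CoresHomExact 𝒲 Q δ η

/-- `M` has finite `𝒴`-projective dimension: it admits a resolution
`0 → Y_n → ⋯ → Y_0 → M → 0` with all `Y_i` in `𝒴`, i.e. `M ∈ res^f(𝒴)`. -/
def FinResDim (𝒴 : Set C) (M : C) : Prop :=
  ∃ (n : ℕ) (P : ℕ → C) (d : ∀ k, P (k + 1) ⟶ P k) (ε : P 0 ⟶ M),
    (∀ k ≤ n, P k ∈ 𝒴) ∧ (∀ k, n < k → IsZero (P k)) ∧ IsResolution P d M ε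

/-- `M` has finite `𝒳`-injective dimension: it admits a coresolution
`0 → M → X^0 → ⋯ → X^n → 0` with all `X^i` in `𝒳`, i.e. `M ∈ cores^f(𝒳)`. -/
def FinCoresDim (𝒳 : Set C) (M : C) : Prop :=
  ∃ (n : ℕ) (Q : ℕ → C) (δ : ∀ k, Q k ⟶ Q (k + 1)) (η : M ⟶ Q 0),
    (∀ k ≤ n, Q k ∈ 𝒳) ∧ (∀ k, n < k → IsZero (Q k)) ∧ IsCoresolution Q δ M η

/-- The `ℤ`-indexed complex `(X, d)` is totally `𝒳`-acyclic: all terms lie in `𝒳`,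
it is exact, and `Hom(W, -)` and `Hom(-, W)` applied to it are exact for all `W ∈ 𝒳`. -/
structure IsTotallyAcyclic (𝒳 : Set C) (X : ℤ → C) (d : ∀ n : ℤ, X (n + 1) ⟶ X n) :
    Prop where
  mem : ∀ n, X n ∈ 𝒳
  w : ∀ n, d (n + 1) ≫ d n = 0
  exact : ∀ n, (ShortComplex.mk (d (n + 1)) (d n) (w n)).Exact
  homExact : ∀ W ∈ 𝒳, ∀ (n : ℤ) (φ : W ⟶ X (n + 1)), φ ≫ d n = 0 →
    ∃ ψ : W ⟶ X (n + 1 + 1), ψ ≫ d (n + 1) = φ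
  homExact' : ∀ W ∈ 𝒳, ∀ (n : ℤ) (φ : X (n + 1) ⟶ W), d (n + 1) ≫ φ = 0 →
    ∃ ψ : X n ⟶ W, d n ≫ ψ = φ

/-- The Gorenstein subcategory `G(𝒳)`: objects isomorphic to `Coker(∂₁)` of a totally
`𝒳`-acyclic complex. -/
def GorClass (𝒳 : Set C) : Set C :=
  {M | ∃ (X : ℤ → C) (d : ∀ n : ℤ, X (n + 1) ⟶ X n),
    IsTotallyAcyclic 𝒳 X d ∧ Nonempty (cokernel (d 0) ≅ M)}

/-- Iterated Gorenstein subcategories: `G^0(𝒳) = 𝒳`, `G^{n+1}(𝒳) = G(G^n(𝒳))`. -/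
def GorIter (𝒳 : Set C) : ℕ → Set C
  | 0 => 𝒳
  | n + 1 => GorClass (GorIter 𝒳 n)

/-- The upper triangular matrix morphism `[[a, b], [0, c]]` between biproducts. -/
noncomputable def triMat {P' P'' Q' Q'' : C} (a : P' ⟶ Q') (b : P'' ⟶ Q') (c : P'' ⟶ Q'') :
    P' ⊞ P'' ⟶ Q' ⊞ Q'' :=
  biprod.lift (biprod.fst ≫ a + biprod.snd ≫ b) (biprod.snd ≫ c)

section GorHelpers

namespace GorAux

variable {A : Type u} [Category.{v} A] [Abelian A]

/-- Short exactness. -/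
def SE {X Y Z : A} (f : X ⟶ Y) (g : Y ⟶ Z) : Prop :=
  ∃ w : f ≫ g = 0, (ShortComplex.mk f g w).ShortExact

lemma SE.w {X Y Z : A} {f : X ⟶ Y} {g : Y ⟶ Z} (h : SE f g) : f ≫ g = 0 := h.1

lemma SE.mono {X Y Z : A} {f : X ⟶ Y} {g : Y ⟶ Z} (h : SE f g) : Mono f := h.2.mono_f

lemma SE.epi {X Y Z : A} {f : X ⟶ Y} {g : Y ⟶ Z} (h : SE f g) : Epi g := h.2.epi_g

lemma SE.op {X Y Z : A} {f : X ⟶ Y} {g : Y ⟶ Z} (h : SE f g) : SE g.op f.op :=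
  ⟨by rw [← op_comp, h.w, op_zero], h.2.op⟩

lemma SE.unop {X Y Z : Aᵒᵖ} {f : X ⟶ Y} {g : Y ⟶ Z} (h : SE f g) : SE g.unop f.unop :=
  ⟨by rw [← unop_comp, h.w, unop_zero], h.2.unop⟩

lemma SE.lift {X Y Z : A} {f : X ⟶ Y} {g : Y ⟶ Z} (h : SE f g) {T : A} (x : T ⟶ Y)
    (hx : x ≫ g = 0) : ∃ y : T ⟶ X, y ≫ f = x := by
  have := h.2.mono_f
  exact ⟨h.2.exact.lift x hx, h.2.exact.lift_f x hx⟩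

lemma SE.desc {X Y Z : A} {f : X ⟶ Y} {g : Y ⟶ Z} (h : SE f g) {T : A} (x : Y ⟶ T)
    (hx : f ≫ x = 0) : ∃ y : Z ⟶ T, g ≫ y = x := by
  have := h.2.epi_g
  exact ⟨h.2.exact.desc x hx, h.2.exact.g_desc x hx⟩

lemma SE.mk {X Y Z : A} {f : X ⟶ Y} {g : Y ⟶ Z} (w : f ≫ g = 0) (hf : Mono f) (hg : Epi g)
    (h : ∀ {T : A} (x : T ⟶ Y), x ≫ g = 0 → ∃ y : T ⟶ X, y ≫ f = x) : SE f g := by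
  refine ⟨w, ShortComplex.ShortExact.mk' ?_ hf hg⟩
  rw [ShortComplex.exact_iff_exact_up_to_refinements]
  intro T x hx
  obtain ⟨y, hy⟩ := h x hx
  exact ⟨T, 𝟙 T, inferInstance, y, by simpa using hy.symm⟩

lemma SE.of_iso {X Y Z X' Z' : A} {f : X ⟶ Y} {g : Y ⟶ Z} (h : SE f g) (e : X' ≅ X)
    (e' : Z ≅ Z') : SE (e.hom ≫ f) (g ≫ e'.hom) := by
  have := h.mono
  have := h.epi
  refine SE.mk (by simp [reassoc_of% h.w]) (mono_comp _ _) (epi_comp _ _) ?_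
  intro T x hx
  obtain ⟨y, hy⟩ := h.lift x (by simpa using hx =≫ e'.inv)
  exact ⟨y ≫ e.inv, by simpa using hy⟩

lemma SE.kernel {Y Z : A} (g : Y ⟶ Z) [Epi g] : SE (kernel.ι g) g :=
  SE.mk (by simp) inferInstance inferInstance
    (fun x hx => ⟨kernel.lift g x hx, by simp⟩)

lemma SE.cokernel {Y Z : A} (g : Y ⟶ Z) [Mono g] : SE g (cokernel.π g) := by
  refine ⟨by simp, ShortComplex.ShortExact.mk' ?_ ‹_› inferInstance⟩
  exact ShortComplex.exact_cokernel g

/-- Pullback of two short exact sequences. -/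
lemma pb {X Y Z X' Y' : A} {f : X ⟶ Y} {g : Y ⟶ Z} {f' : X' ⟶ Y'} {g' : Y' ⟶ Z}
    (h : SE f g) (h' : SE f' g') :
    ∃ (P : A) (i : X ⟶ P) (q : P ⟶ Y') (i' : X' ⟶ P) (q' : P ⟶ Y),
      SE i q ∧ SE i' q' ∧ i ≫ q' = f ∧ i' ≫ q = f' ∧ q' ≫ g = q ≫ g' := by
  have := h.epi
  have := h'.epi
  have := h.mono
  have := h'.mono
  obtain ⟨a, ha1, ha2⟩ : ∃ a : X ⟶ pullback g g', a ≫ pullback.fst g g' = f ∧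
      a ≫ pullback.snd g g' = 0 :=
    ⟨pullback.lift f 0 (by simp [h.w]), pullback.lift_fst _ _ _, pullback.lift_snd _ _ _⟩
  obtain ⟨b, hb1, hb2⟩ : ∃ b : X' ⟶ pullback g g', b ≫ pullback.fst g g' = 0 ∧
      b ≫ pullback.snd g g' = f' :=
    ⟨pullback.lift 0 f' (by simp [h'.w]), pullback.lift_fst _ _ _, pullback.lift_snd _ _ _⟩
  refine ⟨pullback g g', a, pullback.snd g g', b, pullback.fst g g', ?_, ?_, ha1, hb2,
    pullback.condition⟩
  · refine SE.mk ha2 ?_ inferInstance ?_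
    · have : Mono (a ≫ pullback.fst g g') := by rwa [ha1]
      exact mono_of_mono _ (pullback.fst g g')
    · intro T x hx
      obtain ⟨y, hy⟩ := h.lift (x ≫ pullback.fst g g')
        (by rw [Category.assoc, pullback.condition, reassoc_of% hx, zero_comp])
      exact ⟨y, by apply pullback.hom_ext <;> simp [hy, hx, ha1, ha2]⟩
  · refine SE.mk hb1 ?_ inferInstance ?_
    · have : Mono (b ≫ pullback.snd g g') := by rwa [hb2]
      exact mono_of_mono _ (pullback.snd g g')
    · intro T x hx
      obtain ⟨y, hy⟩ := h'.lift (x ≫ pullback.snd g g')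
        (by rw [Category.assoc, ← pullback.condition, reassoc_of% hx, zero_comp])
      exact ⟨y, by apply pullback.hom_ext <;> simp [hy, hx, hb1, hb2]⟩

/-- Kernel of a composite of epimorphisms. -/
lemma ti {E' U E N W : A} {i : E' ⟶ U} {p : U ⟶ E} {f : N ⟶ E} {e : E ⟶ W}
    (h : SE i p) (h' : SE f e) :
    ∃ (V : A) (k : V ⟶ U) (a : E' ⟶ V) (b : V ⟶ N),
      SE k (p ≫ e) ∧ SE a b ∧ a ≫ k = i ∧ b ≫ f = k ≫ p := by
  have := h.epi
  have := h'.epi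
  have := h.mono
  have := h'.mono
  have hk := SE.kernel (p ≫ e)
  have hkm := hk.mono
  obtain ⟨a, ha⟩ := hk.lift i (by rw [reassoc_of% h.w, zero_comp])
  obtain ⟨b, hb⟩ := h'.lift (kernel.ι (p ≫ e) ≫ p) (by rw [Category.assoc, hk.w])
  refine ⟨_, kernel.ι (p ≫ e), a, b, hk, SE.mk ?_ ?_ ?_ ?_, ha, hb⟩
  · rw [← cancel_mono f, Category.assoc, hb, reassoc_of% ha, h.w, zero_comp]
  · have : Mono (a ≫ kernel.ι (p ≫ e)) := by rw [ha]; infer_instance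
    exact mono_of_mono _ (kernel.ι (p ≫ e))
  · rw [epi_iff_surjective_up_to_refinements]
    intro T y
    obtain ⟨T', π, hπ, x, hx⟩ := surjective_up_to_refinements_of_epi p (y ≫ f)
    obtain ⟨z, hz⟩ := hk.lift x (by
      rw [← Category.assoc, ← hx]; simp [h'.w])
    refine ⟨T', π, hπ, z, ?_⟩
    rw [← cancel_mono f, Category.assoc, Category.assoc, hb, reassoc_of% hz, hx]
  · intro T x hx
    obtain ⟨y, hy⟩ := h.lift (x ≫ kernel.ι (p ≫ e)) (by
      rw [Category.assoc, ← hb, reassoc_of% hx, zero_comp])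
    exact ⟨y, by rw [← cancel_mono (kernel.ι (p ≫ e)), Category.assoc, ha, hy]⟩

lemma ti' {N E W U X : A} {f : N ⟶ E} {e : E ⟶ W} {j : E ⟶ U} {q : U ⟶ X}
    (h : SE f e) (h' : SE j q) :
    ∃ (V : A) (k : U ⟶ V) (a : V ⟶ X) (b : W ⟶ V),
      SE (f ≫ j) k ∧ SE b a ∧ k ≫ a = q ∧ e ≫ b = j ≫ k := by
  obtain ⟨V, k, a, b, h1, h2, h3, h4⟩ := ti h'.op h.op
  exact ⟨V.unop, k.unop, a.unop, b.unop, h1.unop, h2.unop,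
    Quiver.Hom.op_inj (by simpa using h3), Quiver.Hom.op_inj (by simpa using h4)⟩

/-- One step. -/
def R (𝒲 : Set A) (K M : A) : Prop :=
  ∃ (V : A) (i : K ⟶ V) (p : V ⟶ M), V ∈ 𝒲 ∧ SE i p ∧
    (∀ W ∈ 𝒲, ∀ φ : W ⟶ M, ∃ ψ : W ⟶ V, ψ ≫ p = φ) ∧
    (∀ W ∈ 𝒲, ∀ φ : K ⟶ W, ∃ ψ : V ⟶ W, i ≫ ψ = φ)

/-- Opposite class. -/
def opS (𝒲 : Set A) : Set Aᵒᵖ := {X | X.unop ∈ 𝒲}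

lemma R.op {𝒲 : Set A} {K M : A} (h : R 𝒲 K M) :
    R (opS 𝒲) (Opposite.op M) (Opposite.op K) := by
  obtain ⟨V, i, p, hV, hs, h1, h2⟩ := h
  refine ⟨Opposite.op V, p.op, i.op, hV, hs.op, ?_, ?_⟩
  · intro W hW φ
    obtain ⟨ψ, hψ⟩ := h2 W.unop hW φ.unop
    exact ⟨ψ.op, Quiver.Hom.unop_inj (by simpa using hψ)⟩
  · intro W hW φ
    obtain ⟨ψ, hψ⟩ := h1 W.unop hW φ.unop
    exact ⟨ψ.op, Quiver.Hom.unop_inj (by simpa using hψ)⟩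

lemma R.unop {𝒲 : Set A} {K M : Aᵒᵖ} (h : R (opS 𝒲) K M) :
    R 𝒲 M.unop K.unop := by
  obtain ⟨V, i, p, hV, hs, h1, h2⟩ := h
  refine ⟨V.unop, p.unop, i.unop, hV, hs.unop, ?_, ?_⟩
  · intro W hW φ
    obtain ⟨ψ, hψ⟩ := h2 (Opposite.op W) hW φ.op
    exact ⟨ψ.unop, Quiver.Hom.op_inj (by simpa using hψ)⟩
  · intro W hW φ
    obtain ⟨ψ, hψ⟩ := h1 (Opposite.op W) hW φ.op
    exact ⟨ψ.unop, Quiver.Hom.op_inj (by simpa using hψ)⟩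

lemma R.of_iso {𝒲 : Set A} {K M K' M' : A} (h : R 𝒲 K M) (e : K' ≅ K) (e' : M ≅ M') :
    R 𝒲 K' M' := by
  obtain ⟨V, i, p, hV, hs, h1, h2⟩ := h
  refine ⟨V, _, _, hV, hs.of_iso e e', ?_, ?_⟩
  · intro W hW φ
    obtain ⟨ψ, hψ⟩ := h1 W hW (φ ≫ e'.inv)
    exact ⟨ψ, by rw [reassoc_of% hψ]; simp⟩
  · intro W hW φ
    obtain ⟨ψ, hψ⟩ := h2 W hW (e.inv ≫ φ)
    exact ⟨ψ, by rw [Category.assoc, hψ]; simp⟩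

/-- Stable classes. -/
def IsCo (𝒲 𝒳 : Set A) : Prop :=
  ∀ M ∈ 𝒳, (∃ K ∈ 𝒳, R 𝒲 K M) ∧ (∃ K ∈ 𝒳, R 𝒲 M K)

/-- Largest stable class. -/
def Co (𝒲 : Set A) : Set A := {M | ∃ 𝒳, IsCo 𝒲 𝒳 ∧ M ∈ 𝒳}

lemma Co.isCo (𝒲 : Set A) : IsCo 𝒲 (Co 𝒲) := by
  rintro M ⟨𝒳, h, hM⟩
  obtain ⟨⟨K, hK, hR⟩, ⟨K', hK', hR'⟩⟩ := h M hM
  exact ⟨⟨K, ⟨𝒳, h, hK⟩, hR⟩, ⟨K', ⟨𝒳, h, hK'⟩, hR'⟩⟩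

lemma Co.op {𝒲 : Set A} {M : A} (h : M ∈ Co 𝒲) : Opposite.op M ∈ Co (opS 𝒲) := by
  refine ⟨opS (Co 𝒲), ?_, h⟩
  intro M hM
  obtain ⟨⟨K, hK, hR⟩, ⟨K', hK', hR'⟩⟩ := Co.isCo 𝒲 _ hM
  exact ⟨⟨Opposite.op K', hK', hR'.op⟩, ⟨Opposite.op K, hK, hR.op⟩⟩

lemma Co.unop {𝒲 : Set A} {M : Aᵒᵖ} (h : M ∈ Co (opS 𝒲)) : M.unop ∈ Co 𝒲 := by
  refine ⟨{X | Opposite.op X ∈ Co (opS 𝒲)}, ?_, h⟩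
  intro M hM
  obtain ⟨⟨K, hK, hR⟩, ⟨K', hK', hR'⟩⟩ := Co.isCo _ _ hM
  exact ⟨⟨K'.unop, hK', hR'.unop⟩, ⟨K.unop, hK, hR.unop⟩⟩

lemma Co.of_steps {𝒲 : Set A} {K M K' : A} (hK : K ∈ Co 𝒲) (hK' : K' ∈ Co 𝒲)
    (h : R 𝒲 K M) (h' : R 𝒲 M K') : M ∈ Co 𝒲 := by
  refine ⟨Co 𝒲 ∪ {M}, ?_, Or.inr rfl⟩
  rintro N (hN | rfl)
  · obtain ⟨⟨K, hK, hR⟩, ⟨K', hK', hR'⟩⟩ := Co.isCo 𝒲 _ hN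
    exact ⟨⟨K, Or.inl hK, hR⟩, ⟨K', Or.inl hK', hR'⟩⟩
  · exact ⟨⟨K, Or.inl hK, h⟩, ⟨K', Or.inl hK', h'⟩⟩

/-- Maps into `Y` extend along monomorphisms with cokernel `X`. -/
def E1 (X Y : A) : Prop :=
  ∀ ⦃K B : A⦄ (f : K ⟶ B) (g : B ⟶ X), SE f g → ∀ φ : K ⟶ Y, ∃ ψ : B ⟶ Y, f ≫ ψ = φ

/-- Maps from `X` lift along epimorphisms with kernel `Y`. -/
def E2 (X Y : A) : Prop :=
  ∀ ⦃B D : A⦄ (f : Y ⟶ B) (g : B ⟶ D), SE f g → ∀ φ : X ⟶ D, ∃ ψ : X ⟶ B, ψ ≫ g = φ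

lemma E1.op {X Y : A} (h : E1 X Y) : E2 (Opposite.op Y) (Opposite.op X) := by
  intro B D f g hs φ
  obtain ⟨ψ, hψ⟩ := h _ _ hs.unop φ.unop
  exact ⟨ψ.op, Quiver.Hom.unop_inj (by simpa using hψ)⟩

lemma E2.op {X Y : A} (h : E2 X Y) : E1 (Opposite.op Y) (Opposite.op X) := by
  intro B D f g hs φ
  obtain ⟨ψ, hψ⟩ := h _ _ hs.unop φ.unop
  exact ⟨ψ.op, Quiver.Hom.unop_inj (by simpa using hψ)⟩

lemma E1.unop {X Y : Aᵒᵖ} (h : E1 X Y) : E2 Y.unop X.unop := by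
  intro B D f g hs φ
  obtain ⟨ψ, hψ⟩ := h _ _ hs.op φ.op
  exact ⟨ψ.unop, Quiver.Hom.op_inj (by simpa using hψ)⟩

/-- Standing hypotheses. -/
structure Hyp (𝒲 : Set A) : Prop where
  sum : ∀ ⦃X Y S : A⦄ (i : X ⟶ S) (j : Y ⟶ S) (p : S ⟶ X) (q : S ⟶ Y),
    i ≫ p = 𝟙 X → j ≫ q = 𝟙 Y → i ≫ q = 0 → j ≫ p = 0 → p ≫ i + q ≫ j = 𝟙 S →
    X ∈ 𝒲 → Y ∈ 𝒲 → S ∈ 𝒲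
  e1 : ∀ X ∈ 𝒲, ∀ Y ∈ 𝒲, E1 X Y
  e2 : ∀ X ∈ 𝒲, ∀ Y ∈ 𝒲, E2 X Y

lemma Hyp.op {𝒲 : Set A} (h : Hyp 𝒲) : Hyp (opS 𝒲) where
  sum X Y S i j p q h1 h2 h3 h4 h5 hX hY :=
    h.sum p.unop q.unop i.unop j.unop (by rw [← unop_comp, h1]; rfl)
      (by rw [← unop_comp, h2]; rfl) (by rw [← unop_comp, h4]; rfl)
      (by rw [← unop_comp, h3]; rfl)
      (by rw [← unop_comp, ← unop_comp, ← unop_add, h5]; rfl) hX hY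
  e1 X hX Y hY := (h.e2 _ hY _ hX).op
  e2 X hX Y hY := (h.e1 _ hY _ hX).op

lemma co_e1 {𝒲 : Set A} (h : Hyp 𝒲) {M W : A} (hM : M ∈ Co 𝒲) (hW : W ∈ 𝒲) : E1 M W := by
  intro K B f g hs φ
  obtain ⟨⟨K', hK', ⟨V, i, p, hV, hs', -, hx⟩⟩, -⟩ := Co.isCo 𝒲 M hM
  obtain ⟨P, a, q, a', q', h1, h2, h3, h4, h5⟩ := pb hs hs'
  obtain ⟨φ', hφ'⟩ := h.e1 V hV W hW _ _ h1 φ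
  obtain ⟨χ, hχ⟩ := hx W hW (a' ≫ φ')
  obtain ⟨ψ, hψ⟩ := h2.desc (φ' - q ≫ χ) (by
    rw [Preadditive.comp_sub, reassoc_of% h4, hχ, sub_self])
  refine ⟨ψ, ?_⟩
  rw [← h3, Category.assoc, hψ, Preadditive.comp_sub, reassoc_of% h1.w, hφ']
  simp

lemma co_e2 {𝒲 : Set A} (h : Hyp 𝒲) {M W : A} (hM : M ∈ Co 𝒲) (hW : W ∈ 𝒲) : E2 W M :=
  (co_e1 (W := Opposite.op W) h.op (Co.op hM) hW).unop

/-- Extensions of objects of `Co`. -/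
def ExtCo (𝒲 : Set A) : Set A :=
  {M | ∃ (X Y : A) (f : X ⟶ M) (g : M ⟶ Y), SE f g ∧ X ∈ Co 𝒲 ∧ Y ∈ Co 𝒲}

lemma extCo_left {𝒲 : Set A} (h : Hyp 𝒲) {M : A} (hM : M ∈ ExtCo 𝒲) :
    ∃ K ∈ ExtCo 𝒲, R 𝒲 K M := by
  obtain ⟨X, Y, f, g, hs, hX, hY⟩ := hM
  obtain ⟨⟨K, hK, ⟨V, i, p, hV, ha, hl, hx⟩⟩, -⟩ := Co.isCo 𝒲 X hX
  obtain ⟨⟨K', hK', ⟨V', i', p', hV', ha', hl', hx'⟩⟩, -⟩ := Co.isCo 𝒲 Y hY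
  obtain ⟨l, hlg⟩ := co_e2 h hX hV' _ _ hs p'
  have := hs.mono
  have := hs.epi
  have := ha.mono
  have := ha.epi
  have := ha'.mono
  have := ha'.epi
  let q : V ⊞ V' ⟶ M := biprod.desc (p ≫ f) l
  have hqg : q ≫ g = biprod.snd ≫ p' := by
    apply biprod.hom_ext' <;> simp [q, hs.w, hlg]
  have hq : Epi q := by
    rw [epi_iff_surjective_up_to_refinements]
    intro T y
    obtain ⟨T', π, hπ, x, hx⟩ := surjective_up_to_refinements_of_epi p' (y ≫ g)
    obtain ⟨z, hz⟩ := hs.lift (π ≫ y - x ≫ l) (by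
      rw [Preadditive.sub_comp, Category.assoc, Category.assoc, hlg, hx, sub_self])
    obtain ⟨T'', π', hπ', t, ht⟩ := surjective_up_to_refinements_of_epi p z
    refine ⟨T'', π' ≫ π, epi_comp _ _, biprod.lift t (π' ≫ x), ?_⟩
    simp only [q, biprod.lift_desc]
    rw [← Category.assoc t, ← ht, Category.assoc π' z, hz]
    simp
  have hk := SE.kernel q
  have := hk.mono
  set k := kernel.ι q with hkdef
  obtain ⟨c, hc⟩ := hk.lift (i ≫ biprod.inl) (by simp [q, reassoc_of% ha.w])
  obtain ⟨d, hd⟩ := ha'.lift (k ≫ biprod.snd) (by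
    rw [Category.assoc, ← hqg, reassoc_of% hk.w, zero_comp])
  have hcd : SE c d := by
    refine SE.mk ?_ ?_ ?_ ?_
    · rw [← cancel_mono i', Category.assoc, hd, reassoc_of% hc]; simp
    · have : Mono (c ≫ k) := by rw [hc]; infer_instance
      exact mono_of_mono _ k
    · rw [epi_iff_surjective_up_to_refinements]
      intro T y
      obtain ⟨z, hz⟩ := hs.lift (y ≫ i' ≫ l) (by
        simp only [Category.assoc, hlg, ha'.w, comp_zero])
      obtain ⟨T', π, hπ, t, ht⟩ := surjective_up_to_refinements_of_epi p z
      obtain ⟨s, hs'⟩ := hk.lift (biprod.lift (-t) (π ≫ y ≫ i')) (by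
        simp only [q, biprod.lift_desc, Preadditive.neg_comp]
        rw [← Category.assoc t, ← ht, Category.assoc π z, hz]
        simp)
      refine ⟨T', π, hπ, s, ?_⟩
      rw [← cancel_mono i', Category.assoc, Category.assoc, hd, reassoc_of% hs']
      simp
    · intro T x hx
      have h0 : x ≫ k ≫ biprod.snd = 0 := by rw [← hd, reassoc_of% hx, zero_comp]
      have h1 : x ≫ k = (x ≫ k ≫ biprod.fst) ≫ biprod.inl := by
        apply biprod.hom_ext <;> simp [h0]
      obtain ⟨y, hy⟩ := ha.lift (x ≫ k ≫ biprod.fst) (by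
        have h2 : x ≫ k ≫ q = 0 := by rw [hk.w, comp_zero]
        rw [← Category.assoc x, h1] at h2
        rw [← cancel_mono f]
        simpa [q] using h2)
      refine ⟨y, ?_⟩
      rw [← cancel_mono k, Category.assoc, hc, h1, reassoc_of% hy]
      simp
  refine ⟨_, ⟨K, K', c, d, hcd, hK, hK'⟩, V ⊞ V', k, q, ?_, hk, ?_, ?_⟩
  · exact h.sum biprod.inl biprod.inr biprod.fst biprod.snd (by simp) (by simp) (by simp)
      (by simp) biprod.total hV hV'
  · intro W hW φ
    obtain ⟨ψ, hψ⟩ := hl' W hW (φ ≫ g)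
    obtain ⟨z, hz⟩ := hs.lift (φ - ψ ≫ l) (by
      rw [Preadditive.sub_comp, Category.assoc, hlg, hψ, sub_self])
    obtain ⟨t, ht⟩ := hl W hW z
    refine ⟨biprod.lift t ψ, ?_⟩
    simp only [q, biprod.lift_desc]
    rw [reassoc_of% ht, hz]
    simp
  · intro W hW φ
    obtain ⟨χ, hχ⟩ := hx W hW (c ≫ φ)
    obtain ⟨z, hz⟩ := hcd.desc (φ - k ≫ biprod.fst ≫ χ) (by
      rw [Preadditive.comp_sub, reassoc_of% hc]; simp [hχ])
    obtain ⟨t, ht⟩ := hx' W hW z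
    refine ⟨biprod.desc χ t, ?_⟩
    rw [biprod.desc_eq, Preadditive.comp_add, ← Category.assoc k biprod.snd, ← hd,
      Category.assoc, ht, hz]
    simp

lemma extCo_co {𝒲 : Set A} (h : Hyp 𝒲) {M : A} (hM : M ∈ ExtCo 𝒲) : M ∈ Co 𝒲 := by
  refine ⟨ExtCo 𝒲, ?_, hM⟩
  intro M hM
  refine ⟨extCo_left h hM, ?_⟩
  obtain ⟨X, Y, f, g, hs, hX, hY⟩ := hM
  obtain ⟨K, ⟨X', Y', f', g', hs', hX', hY'⟩, hR⟩ := extCo_left h.op (M := Opposite.op M)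
    ⟨_, _, g.op, f.op, hs.op, Co.op hY, Co.op hX⟩
  exact ⟨K.unop, ⟨_, _, g'.unop, f'.unop, hs'.unop, Co.unop hY', Co.unop hX'⟩, hR.unop⟩

/-- Closure under kernels of epimorphisms. -/
def KE (𝒲 : Set A) : Prop :=
  ∀ ⦃X Y Z : A⦄ (f : X ⟶ Y) (g : Y ⟶ Z), SE f g → Y ∈ 𝒲 → Z ∈ 𝒲 → X ∈ 𝒲

/-- Closure under cokernels of monomorphisms. -/
def CM (𝒲 : Set A) : Prop :=
  ∀ ⦃X Y Z : A⦄ (f : X ⟶ Y) (g : Y ⟶ Z), SE f g → X ∈ 𝒲 → Y ∈ 𝒲 → Z ∈ 𝒲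

open scoped ZeroObject in
lemma W_co {𝒲 : Set A} (hK : KE 𝒲) {W : A} (hW : W ∈ 𝒲) : W ∈ Co 𝒲 := by
  have hz : ∀ M : A, SE (0 : (0 : A) ⟶ M) (𝟙 M) := fun M =>
    SE.mk (by simp) inferInstance inferInstance (fun x hx => ⟨0, by simpa using hx.symm⟩)
  have hz' : ∀ M : A, SE (𝟙 M) (0 : M ⟶ (0 : A)) := fun M =>
    SE.mk (by simp) inferInstance inferInstance (fun x hx => ⟨x, by simp⟩)
  refine ⟨𝒲, ?_, hW⟩
  intro M hM
  have h0 := hK _ _ (hz M) hM hM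
  refine ⟨⟨0, h0, M, 0, 𝟙 M, hM, hz M, fun W _ φ => ⟨φ, by simp⟩, fun W _ φ => ⟨0, ?_⟩⟩,
    ⟨0, h0, M, 𝟙 M, 0, hM, hz' M, fun W _ φ => ⟨0, ?_⟩, fun W _ φ => ⟨φ, by simp⟩⟩⟩
  · exact (isZero_zero A).eq_of_src _ _
  · exact (isZero_zero A).eq_of_tgt _ _

lemma co_KE {𝒲 : Set A} (h : Hyp 𝒲) (hK : KE 𝒲) : KE (Co 𝒲) := by
  intro N' N N'' f g hs hN hN''
  obtain ⟨⟨K'', hK'', ⟨W0, i0, p0, hW0, hs0, -, -⟩⟩, -⟩ := Co.isCo 𝒲 _ hN''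
  obtain ⟨E, n, e, k'', r, hne, hkr, -, -, -⟩ := pb hs hs0
  have hE : E ∈ Co 𝒲 := extCo_co h ⟨_, _, _, _, hkr, hK'', hN⟩
  obtain ⟨⟨E', hE', ⟨WE, i, p, hWE, hip, hl, hx⟩⟩,
    ⟨XE, hXE, ⟨U, j, q, hU, hjq, hl', hx'⟩⟩⟩ := Co.isCo 𝒲 _ hE
  obtain ⟨V, k, a, b, hkp, hab, hak, hbk⟩ := ti hip hne
  obtain ⟨X, c, s, t, hnc, hts, hcs, hct⟩ := ti' hne hjq
  have hV : V ∈ 𝒲 := hK _ _ hkp hWE hW0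
  have hX : X ∈ Co 𝒲 := extCo_co h ⟨_, _, _, _, hts, W_co hK hW0, hXE⟩
  have := hne.mono
  refine Co.of_steps hE' hX ⟨V, a, b, hV, hab, ?_, ?_⟩ ⟨U, n ≫ j, c, hU, hnc, ?_, ?_⟩
  · intro W hW φ
    obtain ⟨ψ, hψ⟩ := hl W hW (φ ≫ n)
    obtain ⟨y, hy⟩ := hkp.lift ψ (by rw [reassoc_of% hψ, hne.w, comp_zero])
    refine ⟨y, ?_⟩
    rw [← cancel_mono n, Category.assoc, hbk, reassoc_of% hy, hψ]
  · intro W hW φ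
    obtain ⟨ψ, hψ⟩ := hx W hW φ
    exact ⟨k ≫ ψ, by rw [reassoc_of% hak, hψ]⟩
  · intro W hW φ
    obtain ⟨ψ, hψ⟩ := hl' W hW (φ ≫ s)
    obtain ⟨z, hz⟩ := hts.lift (φ - ψ ≫ c) (by
      rw [Preadditive.sub_comp, Category.assoc, hcs, hψ, sub_self])
    obtain ⟨y, hy⟩ := h.e2 W hW V hV _ _ hkp z
    refine ⟨ψ + (y ≫ p) ≫ j, ?_⟩
    rw [Preadditive.add_comp, Category.assoc, Category.assoc, ← hct,
      reassoc_of% hy, hz]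
    simp
  · intro W hW φ
    obtain ⟨ψ, hψ⟩ := h.e1 W0 hW0 W hW _ _ hne φ
    obtain ⟨χ, hχ⟩ := hx' W hW ψ
    exact ⟨χ, by rw [Category.assoc, hχ, hψ]⟩

lemma co_CM {𝒲 : Set A} (h : Hyp 𝒲) (hK : CM 𝒲) : CM (Co 𝒲) := by
  intro N' N N'' f g hs hN hN''
  have hK' : KE (opS 𝒲) := fun X Y Z f g hs hY hZ => hK _ _ hs.unop hZ hY
  exact Co.unop (co_KE h.op hK' _ _ hs.op (Co.op hN'') (Co.op hN))

lemma co_gor {𝒲 : Set A} {M : A} (hM : M ∈ Co 𝒲) : M ∈ GorClass 𝒲 := by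
  have hL : ∀ M : Co 𝒲, ∃ K : Co 𝒲, R 𝒲 K.1 M.1 := fun M => by
    obtain ⟨⟨K, hK, hR⟩, -⟩ := Co.isCo 𝒲 M.1 M.2
    exact ⟨⟨K, hK⟩, hR⟩
  have hr : ∀ M : Co 𝒲, ∃ K : Co 𝒲, R 𝒲 M.1 K.1 := fun M => by
    obtain ⟨-, ⟨K, hK, hR⟩⟩ := Co.isCo 𝒲 M.1 M.2
    exact ⟨⟨K, hK⟩, hR⟩
  choose L hL using hL
  choose T hT using hr
  let M0 : Co 𝒲 := ⟨M, hM⟩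
  obtain ⟨Z, hZ0, hZ⟩ : ∃ Z : ℤ → A, Z 0 = M ∧ ∀ n, R 𝒲 (Z (n + 1)) (Z n) := by
    refine ⟨fun n => match n with
      | Int.ofNat k => (L^[k] M0).1
      | Int.negSucc k => (T^[k + 1] M0).1, rfl, ?_⟩
    intro n
    match n with
    | Int.ofNat k =>
      change R 𝒲 (L^[k + 1] M0).1 (L^[k] M0).1
      rw [Function.iterate_succ_apply']
      exact hL _
    | Int.negSucc 0 =>
      exact hT _
    | Int.negSucc (k + 1) =>
      have : Int.negSucc (k + 1) + 1 = Int.negSucc k := by omega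
      rw [this]
      change R 𝒲 (T^[k + 1] M0).1 (T^[k + 1 + 1] M0).1
      rw [Function.iterate_succ_apply' T (k + 1)]
      exact hT _
  choose X i p hX hs hl hx using hZ
  have := fun n => (hs n).mono
  have := fun n => (hs n).epi
  have w : ∀ n, (p (n + 1 + 1) ≫ i (n + 1)) ≫ (p (n + 1) ≫ i n) = 0 := fun n => by
    rw [Category.assoc, reassoc_of% (hs (n + 1)).w]; simp
  have key : ∀ {W : A} (n : ℤ) (φ : W ⟶ X (n + 1)), φ ≫ p (n + 1) ≫ i n = 0 →
      ∃ ψ : W ⟶ Z (n + 1 + 1), ψ ≫ i (n + 1) = φ := fun n φ hφ =>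
    (hs (n + 1)).lift φ (by rw [← cancel_mono (i n), Category.assoc, hφ, zero_comp])
  refine ⟨X, fun n => p (n + 1) ≫ i n, ⟨hX, w, ?_, ?_, ?_⟩, ⟨?_⟩⟩
  · intro n
    rw [ShortComplex.exact_iff_exact_up_to_refinements]
    intro W x hx
    obtain ⟨y, hy⟩ := key n x hx
    obtain ⟨T', π, hπ, t, ht⟩ := surjective_up_to_refinements_of_epi (p (n + 1 + 1)) y
    exact ⟨T', π, hπ, t, by simp only; rw [← hy, reassoc_of% ht]⟩
  · intro W hW n φ hφ
    obtain ⟨y, hy⟩ := key n φ hφ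
    obtain ⟨t, ht⟩ := hl (n + 1 + 1) W hW y
    exact ⟨t, by rw [reassoc_of% ht, hy]⟩
  · intro W hW n φ hφ
    obtain ⟨y, hy⟩ := (hs (n + 1)).desc φ (by
      rw [← cancel_epi (p (n + 1 + 1)), ← Category.assoc, hφ, comp_zero])
    obtain ⟨t, ht⟩ := hx n W hW y
    exact ⟨t, by rw [Category.assoc, ht, hy]⟩
  · refine cokernelEpiComp (p (0 + 1)) (i 0) ≪≫ ?_ ≪≫ eqToIso hZ0
    exact (cokernelIsCokernel (i 0)).coconePointUniqueUpToIso (hs 0).2.gIsCokernel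

lemma gor_co {𝒲 : Set A} {M : A} (hM : M ∈ GorClass 𝒲) : M ∈ Co 𝒲 := by
  obtain ⟨X, d, h, ⟨e⟩⟩ := hM
  have hR : ∀ n, R 𝒲 (cokernel (d (n + 1))) (cokernel (d n)) := by
    intro n
    have hm : ∀ n, Mono (cokernel.desc (d (n + 1)) (d n) (h.w n)) :=
      fun n => (h.exact n).mono_cokernelDesc
    have := hm n
    have hs : SE (cokernel.desc (d (n + 1)) (d n) (h.w n)) (cokernel.π (d n)) := by
      obtain ⟨w, hw⟩ := SE.cokernel (cokernel.desc (d (n + 1)) (d n) (h.w n))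
      have w' : cokernel.desc (d (n + 1)) (d n) (h.w n) ≫ cokernel.π (d n) = 0 := by
        rw [← cancel_epi (cokernel.π (d (n + 1)))]; simp
      refine SE.mk w' (hm n) inferInstance ?_
      intro T x hx
      have h2 : cokernel.π (d (n + 1)) ≫ cokernel.desc (d (n + 1)) (d n) (h.w n) = d n := by simp
      obtain ⟨y, hy⟩ := (show SE _ _ from ⟨w, hw⟩).lift x (by
        have : d n ≫ cokernel.π (cokernel.desc (d (n + 1)) (d n) (h.w n)) = 0 := by
          have h4 := cokernel.π (d (n + 1)) ≫= w
          rw [← Category.assoc, h2, comp_zero] at h4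
          exact h4
        have h3 : cokernel.π (cokernel.desc (d (n + 1)) (d n) (h.w n)) =
          cokernel.π (d n) ≫ cokernel.desc (d n) _ this := by simp
        rw [h3, reassoc_of% hx, zero_comp])
      exact ⟨y, hy⟩
    refine ⟨X n, _, _, h.mem n, hs, ?_, ?_⟩
    · obtain ⟨m, rfl⟩ : ∃ m, n = m + 1 + 1 := ⟨n - 2, by ring⟩
      intro W hW φ
      have := hm (m + 1)
      have := hm m
      have h0 : cokernel.desc (d (m + 1 + 1)) (d (m + 1)) (h.w (m + 1)) ≫ d m = 0 := by
        rw [← cancel_epi (cokernel.π _)]; simp [h.w]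
      obtain ⟨ψ, hψ⟩ := h.homExact W hW m
        (φ ≫ cokernel.desc (d (m + 1 + 1)) (d (m + 1)) (h.w (m + 1))) (by
          rw [Category.assoc, h0, comp_zero])
      refine ⟨ψ, ?_⟩
      rw [← cancel_mono (cokernel.desc (d (m + 1 + 1)) (d (m + 1)) (h.w (m + 1))), ← hψ]
      simp
    · intro W hW φ
      obtain ⟨ψ, hψ⟩ := h.homExact' W hW n (cokernel.π _ ≫ φ) (by simp)
      refine ⟨ψ, ?_⟩
      rw [← cancel_epi (cokernel.π _), ← hψ]
      simp
  refine ⟨{M | ∃ n, Nonempty (cokernel (d n) ≅ M)}, ?_, ⟨0, ⟨e⟩⟩⟩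
  rintro M ⟨n, ⟨e⟩⟩
  obtain ⟨m, rfl⟩ : ∃ m, n = m + 1 := ⟨n - 1, by ring⟩
  exact ⟨⟨_, ⟨m + 1 + 1, ⟨Iso.refl _⟩⟩, (hR (m + 1)).of_iso (Iso.refl _) e⟩,
    ⟨_, ⟨m, ⟨Iso.refl _⟩⟩, (hR m).of_iso e.symm (Iso.refl _)⟩⟩

lemma gor_eq (𝒲 : Set A) : GorClass 𝒲 = Co 𝒲 :=
  Set.Subset.antisymm (fun _ h => gor_co h) (fun _ h => co_gor h)

lemma ext_e1 [HasExt.{w} A] {X Y : A} (h : extPerp X Y) : E1 X Y := by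
  rintro K B f g ⟨w, hs⟩ φ
  have := h 1 le_rfl
  obtain ⟨x, hx⟩ := Ext.contravariant_sequence_exact₁ hs Y (Ext.mk₀ φ) (n₁ := 1) rfl
    (Subsingleton.elim _ _)
  obtain ⟨ψ, rfl⟩ := (Ext.mk₀_bijective _ _).2 x
  rw [Ext.mk₀_comp_mk₀] at hx
  exact ⟨ψ, (Ext.mk₀_bijective _ _).1 hx⟩

lemma ext_e2 [HasExt.{w} A] {X Y : A} (h : extPerp X Y) : E2 X Y := by
  rintro K B f g ⟨w, hs⟩ φ
  have := h 1 le_rfl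
  obtain ⟨x, hx⟩ := Ext.covariant_sequence_exact₃ X hs (Ext.mk₀ φ) (n₁ := 1) rfl
    (Subsingleton.elim _ _)
  obtain ⟨ψ, rfl⟩ := (Ext.mk₀_bijective _ _).2 x
  rw [Ext.mk₀_comp_mk₀] at hx
  exact ⟨ψ, (Ext.mk₀_bijective _ _).1 hx⟩

end GorAux

end GorHelpers

variable [EnoughProjectives C] [EnoughInjectives C] [HasExt.{w} C]

/-- Theorem 3.12: assume `𝒲 ⊥ 𝒲`. (a) If `𝒲` is closed under kernels of
epimorphisms, then so is `G(𝒲)`. (b) If `𝒲` is closed under cokernels of monomorphisms,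
then so is `G(𝒲)`. -/
theorem stmt_17 (𝒲 : Set C) (h𝒲iso : IsoClosed 𝒲) (h𝒲sum : SumClosed 𝒲)
    (hperp : ∀ W ∈ 𝒲, ∀ W' ∈ 𝒲, extPerp W W') :
    (KerEpiClosed 𝒲 → KerEpiClosed (GorClass 𝒲)) ∧
    (CokerMonoClosed 𝒲 → CokerMonoClosed (GorClass 𝒲)) := by
  open GorAux in
  have hyp : Hyp 𝒲 := by
    refine ⟨?_, fun X hX Y hY => ext_e1 (hperp X hX Y hY),
      fun X hX Y hY => ext_e2 (hperp X hX Y hY)⟩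
    intro X Y S i j p q h1 h2 h3 h4 h5 hX hY
    refine h𝒲iso (A := X ⊞ Y) ⟨biprod.desc i j, biprod.lift p q, ?_, ?_⟩ (h𝒲sum hX hY)
    · apply biprod.hom_ext' <;> apply biprod.hom_ext <;> simp [h1, h2, h3, h4]
    · simpa using h5
  rw [GorAux.gor_eq]
  constructor
  · intro hK X Y Z f g w hs hY hZ
    exact GorAux.co_KE hyp (fun X Y Z f g h => hK f g h.1 h.2) f g ⟨w, hs⟩ hY hZ
  · intro hK X Y Z f g w hs hY hZ
    exact GorAux.co_CM hyp (fun X Y Z f g h => hK f g h.1 h.2) f g ⟨w, hs⟩ hY hZ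
end

section
/- Let R be a commutative ring and let G = ⋯ → G₁ → G₀ → G₋₁ → ⋯ be an exact complex of Gorenstein projective R-modules such that the complexes Hom_R(G, H) and Hom_R(H, G) are exact for every Gorenstein projective R-module H. Then the module Coker(∂^G_1) is Gorenstein projective. Equivalently, G²(P(R)) = G(P(R)): iterating the Gorenstein-projective construction yields exactly the Gorenstein projective modules. -/
open CategoryTheory CategoryTheory.Limits CategoryTheory.Abelian

universe w v u

variable {C : Type u} [Category.{v} C] [Abelian C]

namespace GorAux

/-- Unbundled short exact sequence. -/
def SES {A B D : C} (f : A ⟶ B) (g : B ⟶ D) : Prop :=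
  ∃ w : f ≫ g = 0, (ShortComplex.mk f g w).ShortExact

lemma SES.w {A B D : C} {f : A ⟶ B} {g : B ⟶ D} (h : SES f g) : f ≫ g = 0 := h.1
lemma SES.mono {A B D : C} {f : A ⟶ B} {g : B ⟶ D} (h : SES f g) : Mono f := h.2.mono_f
lemma SES.epi {A B D : C} {f : A ⟶ B} {g : B ⟶ D} (h : SES f g) : Epi g := h.2.epi_g

lemma SES.lift {A B D : C} {f : A ⟶ B} {g : B ⟶ D} (h : SES f g) {T : C} (k : T ⟶ B)
    (hk : k ≫ g = 0) : ∃ l : T ⟶ A, l ≫ f = k := by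
  obtain ⟨w, h⟩ := h
  have := h.mono_f
  exact ⟨h.exact.lift k hk, h.exact.lift_f k hk⟩

lemma SES.desc {A B D : C} {f : A ⟶ B} {g : B ⟶ D} (h : SES f g) {T : C} (k : B ⟶ T)
    (hk : f ≫ k = 0) : ∃ l : D ⟶ T, g ≫ l = k := by
  obtain ⟨w, h⟩ := h
  have := h.epi_g
  exact ⟨h.exact.desc k hk, h.exact.g_desc k hk⟩

lemma SES.mk_desc {A B D : C} {f : A ⟶ B} {g : B ⟶ D} [Mono f] [Epi g] (w : f ≫ g = 0)
    (h : ∀ (T : C) (k : B ⟶ T), f ≫ k = 0 → ∃ l : D ⟶ T, g ≫ l = k) : SES f g := by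
  refine ⟨w, ?_⟩
  have : (ShortComplex.mk f g w).Exact := by
    apply ShortComplex.exact_of_g_is_cokernel
    choose l hl using h
    refine CokernelCofork.IsColimit.ofπ _ _ (fun k hk => l _ k hk) (fun k hk => hl _ k hk) ?_
    intro T k hk m hm
    exact (cancel_epi g).1 (hm.trans (hl _ k hk).symm)
  exact { exact := this, mono_f := ‹_›, epi_g := ‹_› }

/-- pushout of a short exact sequence -/
lemma SES.pushout {A B D X : C} {f : A ⟶ B} {g : B ⟶ D} (h : SES f g) (a : A ⟶ X) :
    ∃ q : pushout a f ⟶ D, SES (pushout.inl a f) q ∧ pushout.inr a f ≫ q = g := by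
  have := h.mono
  have := h.epi
  refine ⟨pushout.desc 0 g (by simp [h.w]), ?_, pushout.inr_desc _ _ _⟩
  have e : Epi (pushout.desc 0 g (by simp [h.w]) : Limits.pushout a f ⟶ D) := by
    have : Epi (pushout.inr a f ≫ (pushout.desc 0 g (by simp [h.w]) : Limits.pushout a f ⟶ D)) := by
      rwa [pushout.inr_desc]
    exact epi_of_epi (pushout.inr a f) _
  refine SES.mk_desc (pushout.inl_desc _ _ _) ?_
  intro T k hk
  obtain ⟨l, hl⟩ := h.desc (pushout.inr a f ≫ k) (by
    rw [← pushout.condition_assoc, hk, comp_zero])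
  refine ⟨l, ?_⟩
  apply pushout.hom_ext
  · rw [pushout.inl_desc_assoc, hk, zero_comp]
  · rw [pushout.inr_desc_assoc, hl]

/-- composition of admissible monos -/
lemma SES.compose {B E A' Q E' : C} {f : B ⟶ E} {g : E ⟶ A'} (h : SES f g)
    {i : E ⟶ Q} {p : Q ⟶ E'} (h' : SES i p) :
    ∃ (B' : C) (π : Q ⟶ B') (u : A' ⟶ B') (v : B' ⟶ E'), SES (f ≫ i) π ∧ SES u v := by
  obtain ⟨q, hq, -⟩ := h'.pushout g
  have := h.mono
  have := h.epi
  have := h'.mono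
  refine ⟨Limits.pushout g i, pushout.inr g i, pushout.inl g i, q, ?_, hq⟩
  refine SES.mk_desc ?_ ?_
  · rw [Category.assoc, ← pushout.condition, ← Category.assoc, h.w, zero_comp]
  · intro T k hk
    obtain ⟨s, hs⟩ := h.desc (i ≫ k) (by simpa using hk)
    exact ⟨pushout.desc s k hs, pushout.inr_desc _ _ _⟩

lemma SES.embed {A B D X A' : C} {f : A ⟶ B} {g : B ⟶ D} (h : SES f g)
    {i : A ⟶ X} {p : X ⟶ A'} (h' : SES i p) :
    ∃ (E : C) (a : X ⟶ E) (b : E ⟶ D) (c : B ⟶ E) (e : E ⟶ A'), SES a b ∧ SES c e := by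
  obtain ⟨q, hq, -⟩ := h.pushout i
  have := h.mono
  have := h'.mono
  have := h'.epi
  have hw : i ≫ p = f ≫ 0 := by simp [h'.w]
  have e : Epi (pushout.desc p 0 hw : Limits.pushout i f ⟶ A') := by
    have : Epi (pushout.inl i f ≫ (pushout.desc p 0 hw : Limits.pushout i f ⟶ A')) := by
      rwa [pushout.inl_desc]
    exact epi_of_epi (pushout.inl i f) _
  refine ⟨_, _, q, pushout.inr i f, pushout.desc p 0 hw, hq, ?_⟩
  refine SES.mk_desc (pushout.inr_desc _ _ _) ?_
  intro T k hk
  obtain ⟨l, hl⟩ := h'.desc (pushout.inl i f ≫ k) (by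
    rw [pushout.condition_assoc, hk, comp_zero])
  refine ⟨l, ?_⟩
  apply pushout.hom_ext
  · rw [pushout.inl_desc_assoc, hl]
  · rw [pushout.inr_desc_assoc, hk, zero_comp]

/-- One step of a totally acyclic complex. -/
def Step (𝒳 : Set C) (A B : C) : Prop :=
  ∃ (X : C) (i : A ⟶ X) (p : X ⟶ B), X ∈ 𝒳 ∧ SES i p ∧
    (∀ W ∈ 𝒳, ∀ φ : W ⟶ B, ∃ ψ : W ⟶ X, ψ ≫ p = φ) ∧
    (∀ W ∈ 𝒳, ∀ φ : A ⟶ W, ∃ ψ : X ⟶ W, i ≫ ψ = φ)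

lemma mem_of_family {𝒳 : Set C} (K : ℤ → C) (h : ∀ n, Step 𝒳 (K (n + 1)) (K n)) :
    K 0 ∈ GorClass 𝒳 := by
  choose X i p hX hs h1 h2 using h
  have hm := fun n => (hs n).mono
  have he := fun n => (hs n).epi
  have hw : ∀ n, (p (n+1+1) ≫ i (n+1)) ≫ (p (n+1) ≫ i n) = 0 := by
    intro n
    have := (hs (n+1)).w
    simp [reassoc_of% this]
  refine ⟨X, fun n => p (n+1) ≫ i n, ⟨hX, hw, ?_, ?_, ?_⟩, ?_⟩
  · intro n
    rw [ShortComplex.exact_iff_exact_up_to_refinements]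
    intro T k hk
    dsimp at hk k
    obtain ⟨l, hl⟩ := (hs (n+1)).lift k (by
      rw [← cancel_mono (i n)]; simpa using hk)
    obtain ⟨T', π, hπ, y, hy⟩ := surjective_up_to_refinements_of_epi (p (n+1+1)) l
    refine ⟨T', π, hπ, y, ?_⟩
    dsimp
    rw [← hl, ← Category.assoc, ← Category.assoc, hy]
  · intro W hW n φ hφ
    obtain ⟨l, hl⟩ := (hs (n+1)).lift φ (by
      rw [← cancel_mono (i n)]; simpa using hφ)
    obtain ⟨ψ, hψ⟩ := h1 (n+1+1) W hW l
    exact ⟨ψ, by rw [← hl, ← hψ, Category.assoc]⟩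
  · intro W hW n φ hφ
    obtain ⟨l, hl⟩ := (hs (n+1)).desc φ (by
      rw [← cancel_epi (p (n+1+1))]; simpa using hφ)
    obtain ⟨ψ, hψ⟩ := h2 n W hW l
    exact ⟨ψ, by rw [← hl, ← hψ, Category.assoc]⟩
  · have hz : (p (0+1) ≫ i 0) ≫ p 0 = 0 := by simp [(hs 0).w]
    refine ⟨?_⟩
    have hc : ∀ (T : C) (k : X 0 ⟶ T), (p (0+1) ≫ i 0) ≫ k = 0 → ∃ l, p 0 ≫ l = k := by
      intro T k hk
      refine (hs 0).desc k ?_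
      rw [← cancel_epi (p (0+1))]
      simpa using hk
    choose l hl using hc
    have c : IsColimit (CokernelCofork.ofπ (p 0) hz) :=
      CokernelCofork.IsColimit.ofπ _ _ (fun k hk => l _ k hk) (fun k hk => hl _ k hk)
        (fun k hk m hm => (cancel_epi (p 0)).1 (hm.trans (hl _ k hk).symm))
    exact (cokernelIsCokernel (p (0+1) ≫ i 0)).coconePointUniqueUpToIso c

lemma mem_of_family' {𝒳 : Set C} (K : ℤ → C) (h : ∀ n, Step 𝒳 (K (n + 1)) (K n)) (m : ℤ) :
    K m ∈ GorClass 𝒳 := by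
  have := mem_of_family (𝒳 := 𝒳) (fun n => K (n + m)) (fun n => by
    have := h (n + m)
    rwa [add_right_comm] at this)
  simpa using this

lemma family_of_acyclic {𝒳 : Set C} {X : ℤ → C} {d : ∀ n : ℤ, X (n + 1) ⟶ X n}
    (h : IsTotallyAcyclic 𝒳 X d) (n : ℤ) :
    Step 𝒳 (cokernel (d (n + 1))) (cokernel (d n)) := by
  have key : ∀ n, SES (cokernel.desc (d (n+1)) (d n) (h.w n)) (cokernel.π (d n)) := by
    intro n
    have : Mono (cokernel.desc (d (n+1)) (d n) (h.w n)) := (h.exact n).mono_cokernelDesc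
    refine SES.mk_desc ?_ ?_
    · rw [← cancel_epi (cokernel.π (d (n+1)))]; simp
    · intro T k hk
      refine ⟨cokernel.desc _ k ?_, cokernel.π_desc _ _ _⟩
      rw [← cokernel.π_desc (d (n+1)) (d n) (h.w n), Category.assoc, hk, comp_zero]
  refine ⟨X n, _, _, h.mem n, key n, ?_, ?_⟩
  · intro W hW φ
    obtain ⟨k, rfl⟩ : ∃ k, n = k + 1 + 1 := ⟨n - 2, by ring⟩
    have := (key (k+1)).mono
    obtain ⟨ψ, hψ⟩ := h.homExact W hW k (φ ≫ cokernel.desc _ (d (k+1)) (h.w (k+1))) (by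
      have : cokernel.desc _ (d (k+1)) (h.w (k+1)) ≫ d k = 0 := by
        rw [← cancel_epi (cokernel.π _)]; simp [h.w]
      simp [this])
    refine ⟨ψ, ?_⟩
    rw [← cancel_mono (cokernel.desc _ (d (k+1)) (h.w (k+1)))]
    simpa using hψ
  · intro W hW φ
    obtain ⟨ψ, hψ⟩ := h.homExact' W hW n (cokernel.π _ ≫ φ) (by simp)
    refine ⟨ψ, ?_⟩
    rw [← cancel_epi (cokernel.π _)]
    simpa using hψ

lemma Step.iso_left {𝒳 : Set C} {A A' B : C} (h : Step 𝒳 A B) (e : A ≅ A') : Step 𝒳 A' B := by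
  obtain ⟨X, i, p, hX, hs, h1, h2⟩ := h
  have := hs.mono
  have := hs.epi
  refine ⟨X, e.inv ≫ i, p, hX, SES.mk_desc (by simp [hs.w]) ?_, h1, ?_⟩
  · intro T k hk
    refine hs.desc k ?_
    rw [← cancel_epi e.inv]; simpa using hk
  · intro W hW φ
    obtain ⟨ψ, hψ⟩ := h2 W hW (e.hom ≫ φ)
    exact ⟨ψ, by simp [hψ]⟩

lemma Step.iso_right {𝒳 : Set C} {A B B' : C} (h : Step 𝒳 A B) (e : B ≅ B') : Step 𝒳 A B' := by
  obtain ⟨X, i, p, hX, hs, h1, h2⟩ := h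
  have := hs.mono
  have := hs.epi
  refine ⟨X, i, p ≫ e.hom, hX, SES.mk_desc (by simp [reassoc_of% hs.w]) ?_, ?_, h2⟩
  · intro T k hk
    obtain ⟨l, hl⟩ := hs.desc k hk
    exact ⟨e.inv ≫ l, by simp [hl]⟩
  · intro W hW φ
    obtain ⟨ψ, hψ⟩ := h1 W hW (φ ≫ e.inv)
    exact ⟨ψ, by simp [reassoc_of% hψ]⟩

lemma exists_right {𝒳 : Set C} {M : C} (h : M ∈ GorClass 𝒳) : ∃ M' ∈ GorClass 𝒳, Step 𝒳 M M' := by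
  obtain ⟨X, d, h, ⟨e⟩⟩ := h
  refine ⟨cokernel (d (-1)), mem_of_family' (fun n => cokernel (d n)) (family_of_acyclic h) (-1), ?_⟩
  exact (family_of_acyclic h (-1)).iso_left e

lemma exists_left {𝒳 : Set C} {M : C} (h : M ∈ GorClass 𝒳) : ∃ M' ∈ GorClass 𝒳, Step 𝒳 M' M := by
  obtain ⟨X, d, h, ⟨e⟩⟩ := h
  refine ⟨cokernel (d 1), mem_of_family' (fun n => cokernel (d n)) (family_of_acyclic h) 1, ?_⟩
  exact (family_of_acyclic h 0).iso_right e

lemma mem_of_chains {𝒳 L Rt : Set C} (hL : ∀ M ∈ L, ∃ M' ∈ L, Step 𝒳 M' M)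
    (hR : ∀ M ∈ Rt, ∃ M' ∈ Rt, Step 𝒳 M M') {M : C} (h1 : M ∈ L) (h2 : M ∈ Rt) :
    M ∈ GorClass 𝒳 := by
  choose! l hl hl' using hL
  choose! r hr hr' using hR
  have al : ∀ n : ℕ, (l^[n] M) ∈ L := by
    intro n
    induction n with
    | zero => exact h1
    | succ n ih => rw [Function.iterate_succ_apply']; exact hl _ ih
  have ar : ∀ n : ℕ, (r^[n] M) ∈ Rt := by
    intro n
    induction n with
    | zero => exact h2
    | succ n ih => rw [Function.iterate_succ_apply']; exact hr _ ih
  have := mem_of_family (𝒳 := 𝒳) (fun n : ℤ => if 0 ≤ n then l^[n.toNat] M else r^[(-n).toNat] M) ?_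
  · simpa using this
  · intro n
    rcases lt_or_ge n 0 with hn | hn
    · obtain ⟨k, rfl⟩ : ∃ k : ℕ, n = -(k : ℤ) - 1 := ⟨(-n-1).toNat, by omega⟩
      have e1 : (-(-(k:ℤ) - 1)).toNat = k + 1 := by omega
      have e2 : (-(-(k:ℤ) - 1 + 1)).toNat = k := by omega
      have : (if 0 ≤ -(k:ℤ) - 1 + 1 then l^[(-(k:ℤ) - 1 + 1).toNat] M
          else r^[(-(-(k:ℤ) - 1 + 1)).toNat] M) = r^[k] M := by
        rw [e2]
        split_ifs with h
        · have : k = 0 := by omega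
          subst this
          simp
        · rfl
      beta_reduce
      rw [this, if_neg (by omega), e1, Function.iterate_succ_apply']
      exact hr' _ (ar k)
    · obtain ⟨k, rfl⟩ : ∃ k : ℕ, n = k := ⟨n.toNat, by omega⟩
      have e1 : ((k:ℤ)+1).toNat = k + 1 := by omega
      beta_reduce
      rw [if_pos (by omega), if_pos (by omega), e1, Function.iterate_succ_apply']
      exact hl' _ (al k)

lemma ses_biprod (A B : C) : SES (biprod.inl : A ⟶ A ⊞ B) (biprod.snd : A ⊞ B ⟶ B) := by
  refine SES.mk_desc (by simp) ?_
  intro T k hk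
  exact ⟨biprod.inr ≫ k, by apply biprod.hom_ext' <;> simp [hk]⟩

lemma subset_gor {𝒳 : Set C} (h : ∀ A ∈ 𝒳, (A ⊞ A) ∈ 𝒳) : 𝒳 ⊆ GorClass 𝒳 := by
  intro A hA
  refine mem_of_family (fun _ => A) (fun n => ⟨A ⊞ A, biprod.inl, biprod.snd, h A hA,
    ses_biprod A A, ?_, ?_⟩)
  · intro W _ φ
    exact ⟨φ ≫ biprod.inr, by simp⟩
  · intro W _ φ
    exact ⟨biprod.fst ≫ φ, by simp⟩

section ext

variable [HasExt.{w} C]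

lemma perp_mid {A B D W : C} {f : A ⟶ B} {g : B ⟶ D} (h : SES f g)
    (hA : extPerp A W) (hD : extPerp D W) : extPerp B W := by
  intro i hi
  refine subsingleton_of_forall_eq 0 fun x => ?_
  obtain ⟨w, h⟩ := h
  have := hA i hi
  have := hD i hi
  obtain ⟨y, rfl⟩ := Ext.contravariant_sequence_exact₂ h W x (Subsingleton.elim (α := Ext A W i) _ _)
  rw [Subsingleton.elim (α := Ext D W i) y 0]
  simp

lemma perp_left {A B D W : C} {f : A ⟶ B} {g : B ⟶ D} (h : SES f g)
    (hB : extPerp B W) (hD : extPerp D W) : extPerp A W := by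
  intro i hi
  refine subsingleton_of_forall_eq 0 fun x => ?_
  obtain ⟨w, h⟩ := h
  have := hB i hi
  have := hD (1 + i) (by omega)
  obtain ⟨y, rfl⟩ := Ext.contravariant_sequence_exact₁ h W x rfl
    (Subsingleton.elim (α := Ext D W (1 + i)) _ _)
  rw [Subsingleton.elim (α := Ext B W i) y 0]
  simp

lemma extend_of_perp {A B D W : C} {f : A ⟶ B} {g : B ⟶ D} (h : SES f g)
    (hD : extPerp D W) (φ : A ⟶ W) : ∃ ψ : B ⟶ W, f ≫ ψ = φ := by
  obtain ⟨w, h⟩ := h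
  have := hD (1 + 0) (by omega)
  obtain ⟨y, hy⟩ := Ext.contravariant_sequence_exact₁ h W (Ext.mk₀ φ) rfl
    (Subsingleton.elim (α := Ext D W (1 + 0)) _ _)
  obtain ⟨ψ, rfl⟩ := Ext.addEquiv₀.symm.surjective y
  refine ⟨ψ, ?_⟩
  apply Ext.addEquiv₀.symm.injective
  simpa using hy

lemma perp_of_gor {𝒳 : Set C} {W : C} (hW : W ∈ 𝒳) (hp : ∀ X ∈ 𝒳, extPerp X W) {M : C}
    (hM : M ∈ GorClass 𝒳) : extPerp M W := by
  intro i hi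
  induction i, hi using Nat.le_induction generalizing M with
  | base =>
    refine subsingleton_of_forall_eq 0 fun x => ?_
    obtain ⟨M', hM', X, ι, p, hX, ⟨w, h⟩, -, h2⟩ := exists_left hM
    have := hp X hX 1 le_rfl
    obtain ⟨y, rfl⟩ := Ext.contravariant_sequence_exact₃ h W x
      (Subsingleton.elim (α := Ext X W 1) _ _) (n₀ := 0) rfl
    obtain ⟨φ, rfl⟩ := Ext.addEquiv₀.symm.surjective y
    obtain ⟨ψ, rfl⟩ := h2 W hW φ
    have : (Ext.addEquiv₀.symm (ι ≫ ψ)) = (Ext.mk₀ ι).comp (Ext.mk₀ ψ) (zero_add 0) := by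
      simp
    rw [this]
    exact h.extClass_comp_assoc _
  | succ i hi ih =>
    refine subsingleton_of_forall_eq 0 fun x => ?_
    obtain ⟨M', hM', X, ι, p, hX, ⟨w, h⟩, -, h2⟩ := exists_left hM
    have := hp X hX (i+1) (by omega)
    obtain ⟨y, rfl⟩ := Ext.contravariant_sequence_exact₃ h W x
      (Subsingleton.elim (α := Ext X W (i+1)) _ _) (n₀ := i) (by omega)
    have := ih hM'
    rw [Subsingleton.elim (α := Ext M' W i) y 0]
    simp

variable [EnoughProjectives C]

/-- The projectives. -/
def Pr (C : Type u) [Category.{v} C] : Set C := {P | Projective P}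

lemma perp_of_proj {P W : C} (h : P ∈ Pr C) : extPerp P W := by
  intro i hi
  have : Projective P := h
  obtain ⟨k, rfl⟩ : ∃ k, i = k + 1 := ⟨i - 1, by omega⟩
  exact Ext.subsingleton_of_projective P W k

lemma gp_perp {M W : C} (hM : M ∈ GorClass (Pr C)) (hW : W ∈ Pr C) : extPerp M W :=
  perp_of_gor hW (fun _ hX => perp_of_proj hX) hM

lemma gp_of_coresolving {Y : Set C} (h1 : ∀ M ∈ Y, ∀ W ∈ Pr C, extPerp M W)
    (h2 : ∀ M ∈ Y, ∃ (Q M' : C) (i : M ⟶ Q) (p : Q ⟶ M'), Q ∈ Pr C ∧ M' ∈ Y ∧ SES i p) :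
    Y ⊆ GorClass (Pr C) := by
  have lift : ∀ {A B D : C} (f : A ⟶ B) (g : B ⟶ D), SES f g →
      ∀ W ∈ Pr C, ∀ φ : W ⟶ D, ∃ ψ : W ⟶ B, ψ ≫ g = φ := by
    intro A B D f g h W hW φ
    have : Projective W := hW
    have := h.epi
    exact ⟨Projective.factorThru φ g, by simp⟩
  intro M hM
  refine mem_of_chains (L := {M | ∀ W ∈ Pr C, extPerp M W}) (Rt := Y) ?_ ?_ (h1 M hM) hM
  · intro M hM
    have hs : SES (kernel.ι (Projective.π M)) (Projective.π M) := by
      refine ⟨by simp, ?_⟩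
      exact { exact := ShortComplex.exact_of_f_is_kernel _ (kernelIsKernel _)
              mono_f := by dsimp; infer_instance
              epi_g := by dsimp; infer_instance }
    have hP : Projective.over M ∈ Pr C := Projective.projective_over M
    exact ⟨kernel (Projective.π M), fun W hW => perp_left hs (perp_of_proj hP) (hM W hW),
      _, _, _, hP, hs, lift _ _ hs, fun W hW φ => extend_of_perp hs (hM W hW) φ⟩
  · intro M hM
    obtain ⟨Q, M', i, p, hQ, hM', hs⟩ := h2 M hM
    exact ⟨M', hM', Q, i, p, hQ, hs, lift _ _ hs, fun W hW φ => extend_of_perp hs (h1 _ hM' W hW) φ⟩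

lemma gp_core {𝒳 : Set C} (hX : ∀ X ∈ GorClass 𝒳, ∀ W ∈ Pr C, extPerp X W)
    (hE : ∀ {X E D : C} (a : X ⟶ E) (b : E ⟶ D), SES a b → X ∈ 𝒳 → D ∈ GorClass (Pr C) →
      ∃ (Q E' : C) (i : E ⟶ Q) (p : Q ⟶ E'), Q ∈ Pr C ∧ E' ∈ GorClass (Pr C) ∧ SES i p)
    {A B D : C} (f : A ⟶ B) (g : B ⟶ D) (h : SES f g) (hA : A ∈ GorClass 𝒳)
    (hD : D ∈ GorClass (Pr C)) : B ∈ GorClass (Pr C) := by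
  refine gp_of_coresolving (Y := {B | ∃ (A D : C) (f : A ⟶ B) (g : B ⟶ D), SES f g ∧
    A ∈ GorClass 𝒳 ∧ D ∈ GorClass (Pr C)}) ?_ ?_ ⟨A, D, f, g, h, hA, hD⟩
  · rintro B ⟨A, D, f, g, h, hA, hD⟩ W hW
    exact perp_mid h (hX _ hA W hW) (gp_perp hD hW)
  · rintro B ⟨A, D, f, g, h, hA, hD⟩
    obtain ⟨A', hA', X, i, p, hX, hs, -, -⟩ := exists_right hA
    obtain ⟨E, a, b, c, e, h1, h2⟩ := h.embed hs
    obtain ⟨Q, E', j, q, hQ, hE', h3⟩ := hE a b h1 hX hD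
    obtain ⟨B', π, u, v, h4, h5⟩ := h2.compose h3
    exact ⟨Q, B', _, _, hQ, ⟨_, _, _, _, h5, hA', hE'⟩, h4⟩

lemma gp_ext {A B D : C} (f : A ⟶ B) (g : B ⟶ D) (h : SES f g) (hA : A ∈ GorClass (Pr C))
    (hD : D ∈ GorClass (Pr C)) : B ∈ GorClass (Pr C) := by
  refine gp_core (𝒳 := Pr C) (fun X hX W hW => gp_perp hX hW) ?_ f g h hA hD
  intro X E D a b h hX hD
  obtain ⟨D', hD', Q, i, p, hQ, hs, -, -⟩ := exists_right hD
  obtain ⟨r, hr⟩ := extend_of_perp h (gp_perp hD hX) (𝟙 X)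
  have : Projective X := hX
  have : Projective Q := hQ
  have := hs.epi
  have := hs.mono
  have := h.epi
  have : Mono (biprod.lift r (b ≫ i)) := by
    refine Preadditive.mono_of_cancel_zero _ ?_
    intro T t ht
    have t1 : t ≫ r = 0 := by simpa using ht =≫ biprod.fst
    have t2 : t ≫ b = 0 := by
      rw [← cancel_mono i]; simpa using ht =≫ biprod.snd
    obtain ⟨l, rfl⟩ := h.lift t t2
    have : l = 0 := by simpa [hr] using t1
    simp [this]
  refine ⟨X ⊞ Q, D', biprod.lift r (b ≫ i), biprod.snd ≫ p, inferInstanceAs (Projective (X ⊞ Q)),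
    hD', SES.mk_desc (by simp [hs.w]) ?_⟩
  intro T k hk
  have e1 : r ≫ biprod.inl ≫ k + b ≫ i ≫ biprod.inr ≫ k = 0 := by
    rw [biprod.lift_eq] at hk
    simpa using hk
  have e2 : biprod.inl ≫ k = 0 := by
    have := a ≫= e1
    simpa [reassoc_of% hr, reassoc_of% h.w] using this
  obtain ⟨l, hl⟩ := hs.desc (biprod.inr ≫ k) (by
    rw [← cancel_epi b]; simpa [e2] using e1)
  refine ⟨l, ?_⟩
  apply biprod.hom_ext'
  · simp [e2]
  · simp [hl]

lemma pr_sub : Pr C ⊆ GorClass (Pr C) := by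
  refine subset_gor fun A hA => ?_
  have : Projective A := hA
  exact inferInstanceAs (Projective (A ⊞ A))

lemma gp_sub : GorClass (Pr C) ⊆ GorClass (GorClass (Pr C)) :=
  subset_gor fun A hA => gp_ext _ _ (ses_biprod A A) hA hA

lemma sub_gp : GorClass (GorClass (Pr C)) ⊆ GorClass (Pr C) := by
  intro M hM
  obtain ⟨Z, Zz⟩ := HasZeroObject.zero (C := C)
  have hz : Z ∈ GorClass (Pr C) := pr_sub (Projective.of_iso (HasZeroObject.zeroIsoIsInitial Zz.isInitial) Projective.zero_projective)
  refine gp_core (𝒳 := GorClass (Pr C))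
    (fun X hX W hW => perp_of_gor (pr_sub hW) (fun _ hX => gp_perp hX hW) hX) ?_
    (𝟙 M) (0 : M ⟶ Z) ?_ hM hz
  · intro X E D a b h hX hD
    obtain ⟨E', hE', Q, i, p, hQ, hs, -, -⟩ := exists_right (gp_ext a b h hX hD)
    exact ⟨Q, E', i, p, hQ, hE', hs⟩
  · have : Epi (0 : M ⟶ Z) := ⟨fun _ _ _ => Zz.eq_of_src _ _⟩
    refine SES.mk_desc (by simp) ?_
    intro T k hk
    exact ⟨0, by simpa using hk.symm⟩

lemma gor_gor : GorClass (GorClass (Pr C)) = GorClass (Pr C) :=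
  Set.Subset.antisymm sub_gp gp_sub

end ext

end GorAux

/-- Theorem A: over a commutative ring `R`, if `G` is an exact complex of
Gorenstein projective `R`-modules such that `Hom_R(G, H)` and `Hom_R(H, G)` are exact for
every Gorenstein projective module `H`, then `Coker(∂^G_1)` is Gorenstein projective;
equivalently, `G²(P(R)) = G(P(R))`. -/
theorem stmt_18 (R : Type u) [CommRing R] :
    (∀ (G : ℤ → ModuleCat.{u} R) (d : ∀ n : ℤ, G (n + 1) ⟶ G n),
        IsTotallyAcyclic (GorClass {P : ModuleCat.{u} R | Module.Projective R P}) G d →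
        cokernel (d 0) ∈ GorClass {P : ModuleCat.{u} R | Module.Projective R P}) ∧
    GorIter {P : ModuleCat.{u} R | Module.Projective R P} 2 =
      GorIter {P : ModuleCat.{u} R | Module.Projective R P} 1 := by
  have e : {P : ModuleCat.{u} R | Module.Projective R P} = GorAux.Pr (ModuleCat.{u} R) := by
    ext P
    exact IsProjective.iff_projective P
  rw [e]
  refine ⟨fun G d h => ?_, GorAux.gor_gor⟩
  exact GorAux.sub_gp ⟨G, d, h, ⟨Iso.refl _⟩⟩
end
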